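/- Let k, θ_B, θ_E, γ̄_B, γ̄_E be positive reals and R_S ≥ 0, and set u = 2^{R_S} γ̄_E θ_E/(γ̄_B θ_B). Then ∫₀^∞ [Υ(k, 2^{R_S} x/(γ̄_B θ_B))/Γ(k)] · (1/(γ̄_E θ_E)) e^{−x/(γ̄_E θ_E)} dx = u^k · k ∫₀¹ t^{k−1} (1 + u t)^{−(k+1)} dt. (This is Proposition 3 with the Gauss hypergeometric factor ₂F₁(k+1,k;1+k;−u) written via its Euler integral representation k∫₀¹ t^{k−1}(1+ut)^{−(k+1)} dt, and B(k,1) = 1/k.) -/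

import Mathlib

open MeasureTheory Real

noncomputable section

/-- Lower incomplete gamma function `Υ(k, x) = ∫₀^x t^(k-1) e^(-t) dt`. -/
def lowerIncGamma (k x : ℝ) : ℝ := ∫ t in (0:ℝ)..x, t ^ (k - 1) * Real.exp (-t)

theorem intervalIntegrable_lowerIncGamma_integrand {k : ℝ} (hk : 0 < k) {x : ℝ} (hx : 0 ≤ x) :
    IntervalIntegrable (fun t : ℝ => t ^ (k - 1) * Real.exp (-t)) volume 0 x := by
  rw [intervalIntegrable_iff_integrableOn_Ioc_of_le hx]
  have h := Real.GammaIntegral_convergent hk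
  simp_rw [mul_comm (Real.exp _)] at h
  exact h.mono_set Set.Ioc_subset_Ioi_self

theorem lowerIncGamma_nonneg (k : ℝ) {x : ℝ} (hx : 0 ≤ x) : 0 ≤ lowerIncGamma k x :=
  intervalIntegral.integral_nonneg hx fun _ ht =>
    mul_nonneg (Real.rpow_nonneg ht.1 _) (Real.exp_pos _).le

theorem tendsto_lowerIncGamma_atTop {k : ℝ} (hk : 0 < k) :
    Filter.Tendsto (lowerIncGamma k) Filter.atTop (nhds (Real.Gamma k)) := by
  have h := Real.GammaIntegral_convergent hk
  rw [Real.Gamma_eq_integral hk]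
  simp_rw [mul_comm (Real.exp _)] at h ⊢
  exact intervalIntegral_tendsto_integral_Ioi 0 h Filter.tendsto_id

theorem hasDerivAt_lowerIncGamma {k : ℝ} (hk : 0 < k) {x : ℝ} (hx : 0 < x) :
    HasDerivAt (lowerIncGamma k) (x ^ (k - 1) * Real.exp (-x)) x := by
  have hc : ∀ y ∈ Set.Ioi (0:ℝ),
      ContinuousAt (fun t : ℝ => t ^ (k - 1) * Real.exp (-t)) y := fun y hy =>
    (Real.continuousAt_rpow_const y _ (Or.inl (ne_of_gt hy))).mul (by fun_prop)
  exact intervalIntegral.integral_hasDerivAt_right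
    (intervalIntegrable_lowerIncGamma_integrand hk hx.le)
    (ContinuousAt.stronglyMeasurableAtFilter isOpen_Ioi hc x hx) (hc x hx)

theorem continuousWithinAt_lowerIncGamma_zero {k : ℝ} (hk : 0 < k) :
    ContinuousWithinAt (lowerIncGamma k) (Set.Ici 0) 0 := by
  have h := intervalIntegral.continuousOn_primitive_interval (μ := volume) (a := 0) (b := 1)
    (f := fun t : ℝ => t ^ (k - 1) * Real.exp (-t))
    (by
      rw [Set.uIcc_of_le zero_le_one, ← intervalIntegrable_iff_integrableOn_Icc_of_le zero_le_one]
      exact intervalIntegrable_lowerIncGamma_integrand hk zero_le_one)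
  rw [Set.uIcc_of_le zero_le_one] at h
  exact (h 0 (by simp)).mono_of_mem_nhdsWithin (Icc_mem_nhdsGE zero_lt_one)

/-- The Laplace-type transform of the lower incomplete gamma function. -/
theorem integral_lowerIncGamma_mul_exp {k c r : ℝ} (hk : 0 < k) (hc : 0 < c) (hr : 0 < r) :
    ∫ x in Set.Ioi (0:ℝ), lowerIncGamma k (c * x) * (r * Real.exp (-(r * x))) =
      (c / (c + r)) ^ k * Real.Gamma k := by
  have hs : 0 < c + r := add_pos hc hr
  have hscale : ∀ {a : ℝ}, 0 < a →
      ContinuousWithinAt (fun x => lowerIncGamma k (a * x)) (Set.Ici 0) 0 := fun {a} ha => by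
    have h0 : ContinuousWithinAt (lowerIncGamma k) (Set.Ici 0) (a * 0) := by
      simpa using continuousWithinAt_lowerIncGamma_zero hk
    exact h0.comp (f := fun x => a * x) (by fun_prop) fun x hx => mul_nonneg ha.le hx
  have hlim : ∀ {a : ℝ}, 0 < a →
      Filter.Tendsto (fun x => lowerIncGamma k (a * x)) Filter.atTop (nhds (Real.Gamma k)) :=
    fun ha => (tendsto_lowerIncGamma_atTop hk).comp
      (Filter.tendsto_id.const_mul_atTop ha)
  have hexp : Filter.Tendsto (fun x : ℝ => Real.exp (-(r * x))) Filter.atTop (nhds 0) :=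
    Real.tendsto_exp_neg_atTop_nhds_zero.comp (Filter.tendsto_id.const_mul_atTop hr)
  have hderiv : ∀ {a x : ℝ}, 0 < a → 0 < x →
      HasDerivAt (fun y => lowerIncGamma k (a * y))
        ((a * x) ^ (k - 1) * Real.exp (-(a * x)) * a) x := fun {a x} ha hx =>
    (hasDerivAt_lowerIncGamma hk (mul_pos ha hx)).comp x
      (by simpa using (hasDerivAt_id x).const_mul a)
  have h := integral_Ioi_of_hasDerivAt_of_nonneg (a := 0)
    (g := fun x => (c / (c + r)) ^ k * lowerIncGamma k ((c + r) * x) -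
      lowerIncGamma k (c * x) * Real.exp (-(r * x)))
    (g' := fun x => lowerIncGamma k (c * x) * (r * Real.exp (-(r * x))))
    (l := (c / (c + r)) ^ k * Real.Gamma k - Real.Gamma k * 0)
    ((continuousWithinAt_const.mul (hscale hs)).sub ((hscale hc).mul (by fun_prop)))
    (fun x hx => by
      have hx : 0 < x := hx
      have he : HasDerivAt (fun y : ℝ => Real.exp (-(r * y))) (Real.exp (-(r * x)) * -r) x :=
        HasDerivAt.exp (by simpa [neg_mul] using (hasDerivAt_id x).const_mul (-r))
      refine (((hderiv hs hx).const_mul ((c / (c + r)) ^ k)).sub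
        ((hderiv hc hx).mul he)).congr_deriv ?_
      have hpow : (c / (c + r)) ^ k * ((c + r) * x) ^ (k - 1) * (c + r) = (c * x) ^ (k - 1) * c := by
        rw [Real.div_rpow hc.le hs.le, Real.mul_rpow hs.le hx.le, Real.mul_rpow hc.le hx.le,
          Real.rpow_sub_one hs.ne', Real.rpow_sub_one hc.ne']
        have := (Real.rpow_pos_of_pos hs k).ne'
        field_simp
      have hsplit : Real.exp (-((c + r) * x)) = Real.exp (-(c * x)) * Real.exp (-(r * x)) := by
        rw [← Real.exp_add]
        ring_nf
      rw [hsplit]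
      linear_combination Real.exp (-(c * x)) * Real.exp (-(r * x)) * hpow)
    (fun x hx => mul_nonneg (lowerIncGamma_nonneg k (mul_nonneg hc.le (le_of_lt hx)))
      (by positivity))
    (((hlim hs).const_mul _).sub ((hlim hc).mul hexp))
  simpa [lowerIncGamma] using h

theorem mul_integral_rpow_mul_one_add_rpow {k u : ℝ} (hk : 0 < k) (hu : 0 ≤ u) :
    k * ∫ t in (0:ℝ)..1, t ^ (k - 1) * (1 + u * t) ^ (-(k + 1)) = (1 + u) ^ (-k) := by
  have hpos : ∀ {t : ℝ}, 0 ≤ t → 0 < 1 + u * t := fun ht => by positivity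
  have hcont : ContinuousOn (fun t : ℝ => t ^ k * (1 + u * t) ^ (-k)) (Set.Icc 0 1) :=
    (Real.continuous_rpow_const hk.le).continuousOn.mul
      (ContinuousOn.rpow_const (by fun_prop) fun t ht => Or.inl (hpos ht.1).ne')
  have hderiv : ∀ t ∈ Set.Ioo (0:ℝ) 1, HasDerivAt (fun t : ℝ => t ^ k * (1 + u * t) ^ (-k))
      (k * (t ^ (k - 1) * (1 + u * t) ^ (-(k + 1)))) t := fun t ht => by
    have ht0 : 0 < t := ht.1
    have hp := hpos ht0.le
    have hlin : HasDerivAt (fun t : ℝ => 1 + u * t) u t := by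
      simpa using ((hasDerivAt_id t).const_mul u).const_add 1
    refine ((Real.hasDerivAt_rpow_const (p := k) (Or.inl ht0.ne')).mul
      (hlin.rpow_const (p := -k) (Or.inl hp.ne'))).congr_deriv ?_
    rw [neg_add', Real.rpow_sub_one hp.ne', Real.rpow_sub_one ht0.ne']
    field_simp
    ring
  have hnonneg : ∀ t ∈ Set.Ioo (0:ℝ) 1, 0 ≤ k * (t ^ (k - 1) * (1 + u * t) ^ (-(k + 1))) :=
    fun t ht => mul_nonneg hk.le (mul_nonneg (Real.rpow_nonneg ht.1.le _)
      (Real.rpow_nonneg (hpos ht.1.le).le _))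
  have hint := intervalIntegral.integrableOn_deriv_of_nonneg hcont hderiv hnonneg
  rw [← intervalIntegral.integral_const_mul,
    intervalIntegral.integral_eq_sub_of_hasDerivAt_of_le zero_le_one hcont hderiv
      ((intervalIntegrable_iff_integrableOn_Ioc_of_le zero_le_one).2 hint)]
  simp [Real.zero_rpow hk.ne']

/-- Proposition 3, with the hypergeometric factor written through its
Euler integral representation `₂F₁(k+1,k;1+k;−u) = k ∫₀¹ t^{k−1}(1+ut)^{−(k+1)} dt`
and `B(k,1) = 1/k`: the SOP lower bound equals
`u^k · k ∫₀¹ t^{k−1} (1 + u t)^{−(k+1)} dt` with `u = 2^{R_S} γ̄_E θ_E/(γ̄_B θ_B)`. -/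
theorem sop_lower_bound_euler_integral_form
    (k θB θE γB γE RS : ℝ) (hk : 0 < k) (hθB : 0 < θB) (hθE : 0 < θE)
    (hγB : 0 < γB) (hγE : 0 < γE) (hRS : 0 ≤ RS)
    (u : ℝ) (hu : u = (2:ℝ) ^ RS * γE * θE / (γB * θB)) :
    (∫ x in Set.Ioi (0:ℝ),
        (lowerIncGamma k ((2:ℝ) ^ RS * x / (γB * θB)) / Real.Gamma k) *
          ((1 / (γE * θE)) * Real.exp (-x / (γE * θE)))) =
      u ^ k * (k * ∫ t in (0:ℝ)..1, t ^ (k - 1) * (1 + u * t) ^ (-(k + 1))) := by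
  have hc : 0 < (2:ℝ) ^ RS / (γB * θB) := by positivity
  have hr : 0 < 1 / (γE * θE) := by positivity
  have hu0 : 0 < u := hu ▸ by positivity
  have hratio : (2:ℝ) ^ RS / (γB * θB) / ((2:ℝ) ^ RS / (γB * θB) + 1 / (γE * θE)) =
      u / (1 + u) := by
    rw [hu]
    field_simp
    ring
  have hΓ : Real.Gamma k ≠ 0 := (Real.Gamma_pos_of_pos hk).ne'
  rw [mul_integral_rpow_mul_one_add_rpow hk hu0.le, Real.rpow_neg (by positivity),
    ← div_eq_mul_inv, ← Real.div_rpow hu0.le (by positivity), ← hratio]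
  rw [eq_comm, ← mul_div_cancel_right₀ (_ ^ k) hΓ, ← integral_lowerIncGamma_mul_exp hk hc hr,
    ← integral_div]
  refine integral_congr_ae (Filter.Eventually.of_forall fun x => ?_)
  have h1 : (2:ℝ) ^ RS / (γB * θB) * x = (2:ℝ) ^ RS * x / (γB * θB) := by ring
  have h2 : -(1 / (γE * θE) * x) = -x / (γE * θE) := by ring
  simp only [h1, h2]
  ring

end
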